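/- Let H be a verbally closed subgroup of G = G₁ * ⋯ * Gₙ (each Gᵢ finite nontrivial) with Kurosh decomposition whose free factors include conjugates of subgroups H_{i,j₁} and H_{i,j₂} of the same factor Gᵢ. Then for any f, g ∈ Gᵢ and natural numbers k₁, k₂ with f^{k₁} ∈ H_{i,j₁} and f^{k₂} ∈ gH_{i,j₂}g⁻¹, either f^{k₁} = 1 or f^{k₂} = 1. In particular H_{i,j₁} ∩ gH_{i,j₂}g⁻¹ = {1} for all g ∈ Gᵢ. -/

import Mathlib

open Monoid

/-- A subgroup `H` of `G` is *verbally closed* if every coefficient-free equation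
`w(x₁,…,xₙ) = h` with `h ∈ H` that has a solution in `G` also has a solution in `H`. -/
def VerballyClosed {G : Type*} [Group G] (H : Subgroup G) : Prop :=
  ∀ (n : ℕ) (w : FreeGroup (Fin n)) (h : G), h ∈ H →
    (∃ x : Fin n → G, FreeGroup.lift x w = h) →
    ∃ x : Fin n → G, (∀ i, x i ∈ H) ∧ FreeGroup.lift x w = h

section TreeLength
variable {Γ : Type*} [Group Γ]

/-- Axioms of a length function of a free action on (the vertices of) a tree. -/
structure TreeLen (L : Γ → ℤ) : Prop where
  one : L 1 = 0
  eq_one : ∀ g, L g ≤ 0 → g = 1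
  inv : ∀ g, L g⁻¹ = L g
  hyp : ∀ (g k h : Γ) (c : ℤ), c ≤ L g + L k - L (g⁻¹ * k) → c ≤ L k + L h - L (k⁻¹ * h) →
    c ≤ L g + L h - L (g⁻¹ * h)

/-- Twice the Gromov product. -/
def gp (L : Γ → ℤ) (g h : Γ) : ℤ := L g + L h - L (g⁻¹ * h)

namespace TreeLen
variable {L : Γ → ℤ}

theorem hyp' (hL : TreeLen L) (g k h : Γ) (c : ℤ) (h1 : c ≤ gp L g k) (h2 : c ≤ gp L k h) : c ≤ gp L g h :=
  hL.hyp g k h c h1 h2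

theorem gp_comm (hL : TreeLen L) (g h : Γ) : gp L g h = gp L h g := by
  have := hL.inv (g⁻¹ * h)
  simp only [mul_inv_rev, inv_inv] at this
  unfold gp; linarith

theorem gp_nonneg (hL : TreeLen L) (g h : Γ) : 0 ≤ gp L g h := by
  have h1 := hL.inv g
  have h2 := hL.one
  exact hL.hyp' g 1 h 0 (by simp [gp, h1, h2]) (by simp [gp, h2])

theorem mul_le (hL : TreeLen L) (g h : Γ) : L (g * h) ≤ L g + L h := by
  have := hL.gp_nonneg g⁻¹ h
  simp only [gp, inv_inv, hL.inv] at this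
  linarith

theorem nonneg (hL : TreeLen L) (g : Γ) : 0 ≤ L g := by
  by_contra h
  have := hL.eq_one g (by linarith)
  subst this
  rw [hL.one] at h
  exact h le_rfl

/-- the isosceles property -/
theorem iso (hL : TreeLen L) (g k h : Γ) (hlt : gp L k h < gp L g k) : gp L g h = gp L k h := by
  apply le_antisymm
  · by_contra hc
    push Not at hc
    have := hL.hyp' k g h (gp L k h + 1) (by rw [hL.gp_comm k g]; linarith) (by linarith)
    linarith
  · exact hL.hyp' g k h _ hlt.le le_rfl

theorem pow_aux (hL : TreeLen L) (g : Γ) (c : ℤ) (hc : gp L g⁻¹ g = c) (hlt : c < L g) (n : ℕ) :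
    L (g ^ (n + 1)) = L g + n * (L g - c) ∧ gp L (g ^ (n + 1))⁻¹ g = c := by
  induction n with
  | zero => simp [hc]
  | succ n ih =>
    obtain ⟨h1, h2⟩ := ih
    have h3 : L (g ^ (n + 1 + 1)) = L g + (n + 1 : ℕ) * (L g - c) := by
      simp only [gp, inv_inv, ← pow_succ, hL.inv] at h2
      push_cast; linarith
    refine ⟨h3, ?_⟩
    rw [← hc]
    apply hL.iso
    rw [hc]
    have e : ((g ^ (n + 1 + 1))⁻¹)⁻¹ * g⁻¹ = g ^ (n + 1) := by
      rw [inv_inv, pow_succ g (n+1), mul_inv_cancel_right]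
    simp only [gp, e, hL.inv, h1, h3]
    push_cast; linarith

theorem pow_len (hL : TreeLen L) (x : Γ) (hx : 0 < L x) (hx2 : L (x * x) = 2 * L x) (n : ℕ) :
    L (x ^ n) = n * L x := by
  cases n with
  | zero => simp [hL.one]
  | succ n =>
    have := (hL.pow_aux x 0 (by simp [gp, hL.inv, hx2]; ring) hx n).1
    rw [this]; push_cast; ring

/-- Lower bound on products in the cyclically reduced case. -/
theorem gp_pow_le (hL : TreeLen L) (x y : Γ) (hx : 0 < L x) (hx2 : L (x * x) = 2 * L x)
    (h : L y ≤ L (x⁻¹ * y)) (k : ℕ) (hk : 1 ≤ k) :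
    gp L (x ^ k) y = gp L x y ∧ gp L x y ≤ L x := by
  have h1 : gp L x y ≤ L x := by unfold gp; linarith
  refine ⟨?_, h1⟩
  obtain ⟨k, rfl⟩ := Nat.exists_eq_add_of_le' hk
  apply hL.iso
  have e : (x ^ (k + 1))⁻¹ * x = (x ^ k)⁻¹ := by rw [pow_succ']; group
  have a1 := hL.pow_len x hx hx2 (k+1)
  have a2 := hL.pow_len x hx hx2 k
  have : gp L (x ^ (k+1)) x = 2 * L x := by
    simp only [gp, e, hL.inv, a1, a2]; push_cast; ring
  linarith

theorem overlap (hL : TreeLen L) (x y : Γ) (hx : 0 < L x) (hx2 : L (x * x) = 2 * L x)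
    (hy1 : L y ≤ L (x⁻¹ * y)) (hy3 : L y ≤ L (y * x⁻¹))
    (α β : ℕ) (hα : 20 ≤ α) (hβ : 20 ≤ β)
    (hy2 : L y ≤ L (x * y))
    (hbig : 8 * L x < gp L (y * (x ^ β)⁻¹) (x ^ α * y)) : x * y = y * x⁻¹ := by
  have pl := hL.pow_len x hx hx2
  have hxi : 0 < L x⁻¹ := by rwa [hL.inv]
  have hxi2 : L (x⁻¹ * x⁻¹) = 2 * L x⁻¹ := by
    rw [← mul_inv_rev, hL.inv, hL.inv, hx2]
  have hαl : (20 : ℤ) * L x ≤ α * L x := by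
    apply mul_le_mul_of_nonneg_right _ hx.le; exact_mod_cast hα
  -- products
  have q1 := hL.gp_pow_le x y hx hx2 hy1
  have q2 := hL.gp_pow_le x⁻¹ y hxi hxi2 (by rwa [inv_inv])
  have q3 := hL.gp_pow_le x⁻¹ y⁻¹ hxi hxi2 (by
    rw [inv_inv, hL.inv, ← hL.inv (x * y⁻¹)]; simpa using hy3)
  rw [hL.inv] at q2 q3
  set e := gp L x⁻¹ y⁻¹ with he
  have he1 : e ≤ L x := (q3 1 le_rfl).2
  have he0 : 0 ≤ e := hL.gp_nonneg _ _
  -- length of y x^{-k}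
  have yl : ∀ k : ℕ, 1 ≤ k → L (y * (x ^ k)⁻¹) = L y + k * L x - e := by
    intro k hk
    have := (q3 k hk).1
    have e1 : (x⁻¹ ^ k)⁻¹ * y⁻¹ = (y * (x ^ k)⁻¹)⁻¹ := by simp
    unfold gp at this
    rw [e1, hL.inv, hL.inv, inv_pow, hL.inv, pl] at this
    linarith
  have s1 : (2 * α - 1) * L x ≤ gp L (x ^ α * y) (x ^ α) := by
    have e1 : (x ^ α * y)⁻¹ * x ^ α = y⁻¹ := by group
    have e2 : (x⁻¹ ^ α)⁻¹ * y = x ^ α * y := by simp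
    have := (q2 α (by omega))
    have h2 := this.1
    have h3 := this.2
    unfold gp at h2
    rw [e2, inv_pow, hL.inv, pl] at h2
    unfold gp
    rw [e1, hL.inv, pl]
    unfold gp at h3
    linarith
  have s2 : 8 * L x + 1 ≤ gp L (y * (x ^ β)⁻¹) (x ^ α) := by
    apply hL.hyp' _ (x ^ α * y)
    · linarith
    · linarith
  have s3 : gp L y (x ^ α) ≤ L x := by
    rw [hL.gp_comm, (q1 α (by omega)).1]; exact (q1 α (by omega)).2
  have s4 : gp L y (y * (x ^ β)⁻¹) ≤ L x := by
    by_contra hc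
    push Not at hc
    have := hL.hyp' y (y * (x ^ β)⁻¹) (x ^ α) (L x + 1) (by linarith) (by linarith)
    linarith
  have yL : L y ≤ L x := by
    unfold gp at s4
    rw [inv_mul_cancel_left, hL.inv, pl, yl β (by omega)] at s4
    linarith
  have yn := hL.nonneg y
  -- points on the common geodesic
  have u1 : ∀ k : ℕ, 1 ≤ k → k ≤ 3 → 
      2 * L (y * (x ^ k)⁻¹) ≤ gp L (y * (x ^ k)⁻¹) (x ^ α) := by
    intro k hk hk3
    apply hL.hyp' _ (y * (x ^ β)⁻¹)
    · obtain ⟨m, rfl⟩ := Nat.exists_eq_add_of_le (show k ≤ β by omega)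
      have e1 : (y * (x ^ k)⁻¹)⁻¹ * (y * (x ^ (k + m))⁻¹) = (x ^ m)⁻¹ := by
        rw [pow_add]; group
      unfold gp
      rw [e1, hL.inv, pl, yl k hk, yl (k+m) (by omega)]
      push_cast; linarith
    · rw [yl k hk]
      have : (k : ℤ) * L x ≤ 3 * L x := by
        apply mul_le_mul_of_nonneg_right _ hx.le; exact_mod_cast hk3
      linarith
  have a2 := u1 2 (by omega) (by omega)
  have a3 := u1 3 (by omega) (by omega)
  have l2 := yl 2 (by omega)
  have l3 := yl 3 (by omega)
  set u := y * (x ^ 2)⁻¹ with hu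
  set u' := y * (x ^ 3)⁻¹ with hu'
  push_cast at l2 l3
  obtain ⟨m, rfl⟩ := Nat.exists_eq_add_of_le' (show 1 ≤ α by omega)
  have z : gp L x⁻¹ (x ^ (m+1)) = 0 := by
    unfold gp
    rw [inv_inv, ← pow_succ', hL.inv, pl, pl]; push_cast; ring
  have v1 : gp L x⁻¹ u ≤ 0 := by
    by_contra hc
    push Not at hc
    have := hL.hyp' x⁻¹ u (x ^ (m+1)) 1 (by linarith) (by linarith)
    linarith
  have v2 : L (x * u) = L x + L u := by
    have := hL.gp_nonneg x⁻¹ u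
    unfold gp at this v1
    rw [inv_inv, hL.inv] at this v1
    linarith
  have b1 : 2 * L u ≤ gp L u (x ^ m) := by
    apply hL.hyp' _ (x ^ (m+1)) _ _ a2
    have e1 : (x ^ (m+1))⁻¹ * x ^ m = x⁻¹ := by rw [pow_succ]; group
    unfold gp
    rw [e1, hL.inv, pl, pl]
    push_cast at hαl ⊢
    linarith
  have b2 : 2 * L (x * u) ≤ gp L (x * u) (x ^ (m+1)) := by
    have e1 : (x * u)⁻¹ * x ^ (m+1) = u⁻¹ * x ^ m := by rw [pow_succ']; group
    unfold gp at b1 ⊢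
    rw [e1, v2, pl]
    rw [pl] at b1
    push_cast
    linarith
  have fin : 2 * L u' ≤ gp L u' (x * u) := by
    apply hL.hyp' _ (x ^ (m+1)) _ _ a3
    rw [hL.gp_comm]; linarith
  have := hL.eq_one (u'⁻¹ * (x * u)) (by unfold gp at fin; linarith)
  have h5 : u' = x * u := inv_mul_eq_one.mp this
  rw [hu, hu'] at h5
  have h6 : x * y = (x * (y * (x ^ 2)⁻¹)) * x ^ 2 := by group
  rw [h6, ← h5]; group

theorem growth (hL : TreeLen L) (x y : Γ) (hx : 0 < L x) (hx2 : L (x * x) = 2 * L x)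
    (hy1 : L y ≤ L (x⁻¹ * y)) (hy2 : L y ≤ L (x * y))
    (hy3 : L y ≤ L (y * x⁻¹)) (hy4 : L y ≤ L (y * x))
    (α β : ℕ) (hα : 20 ≤ α) (hβ : α + 20 ≤ β) (C : ℤ)
    (hC : ∀ n : ℕ, L ((x ^ α * y * x ^ β * y⁻¹) ^ n) ≤ C + 2 * n) : False := by
  have pl := hL.pow_len x hx hx2
  have C0 : 0 ≤ C := by have := hC 0; simpa [hL.one] using this
  by_cases hcase : x * y = y * x⁻¹
  · have e1 : SemiconjBy y x⁻¹ x := hcase.symm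
    have e2 : y * (x ^ β)⁻¹ = x ^ β * y := by
      have := e1.pow_right β
      rw [inv_pow] at this
      exact this
    have e3 : y * x ^ β * y⁻¹ = (x ^ β)⁻¹ := by
      have h7 : y * (x ^ β)⁻¹ * y⁻¹ = x ^ β := by rw [e2, mul_inv_cancel_right]
      have h8 := congrArg (fun g => g⁻¹) h7
      simp only [mul_inv_rev, inv_inv] at h8
      rw [← h8, mul_assoc]
    obtain ⟨m, rfl⟩ := Nat.exists_eq_add_of_le (show α ≤ β by omega)
    have e4 : x ^ α * y * x ^ (α + m) * y⁻¹ = (x ^ m)⁻¹ := by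
      have : x ^ α * y * x ^ (α + m) * y⁻¹ = x ^ α * (y * x ^ (α + m) * y⁻¹) := by group
      rw [this, e3, add_comm, pow_add]; group
    have := hC (C.toNat + 1)
    rw [e4, inv_pow, hL.inv, ← pow_mul, pl] at this
    have hm : (20 : ℤ) ≤ m := by exact_mod_cast (by omega : 20 ≤ m)
    push_cast at this
    rw [Int.toNat_of_nonneg C0] at this
    nlinarith [mul_nonneg (show (0:ℤ) ≤ m - 20 by linarith) (show (0:ℤ) ≤ C + 1 by linarith),
      mul_nonneg (mul_nonneg (show (0:ℤ) ≤ m by linarith) (show (0:ℤ) ≤ C + 1 by linarith)) (show (0:ℤ) ≤ L x - 1 by linarith)]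
  · set s := x ^ α * y with hs
    set t := x ^ β * y⁻¹ with ht
    have eg : x ^ α * y * x ^ β * y⁻¹ = s * t := by rw [hs, ht]; group
    have hαl : (20 : ℤ) * L x ≤ α * L x := by
      apply mul_le_mul_of_nonneg_right _ hx.le; exact_mod_cast hα
    have hβl : (20 : ℤ) * L x ≤ β * L x := by
      apply mul_le_mul_of_nonneg_right _ hx.le; exact_mod_cast (by omega : 20 ≤ β)
    have c2 : gp L t⁻¹ s ≤ 8 * L x := by
      by_contra hc
      push Not at hc
      apply hcase
      apply hL.overlap x y hx hx2 hy1 hy3 α β hα (by omega) hy2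
      rw [ht] at hc
      simpa using hc
    have ii : ∀ z : Γ, L y⁻¹ ≤ L (z⁻¹ * y⁻¹) ↔ L y ≤ L (y * z) := by
      intro z
      rw [hL.inv, ← mul_inv_rev, hL.inv]
    have ii' : ∀ z : Γ, L y⁻¹ ≤ L (y⁻¹ * z⁻¹) ↔ L y ≤ L (z * y) := by
      intro z
      rw [hL.inv, ← mul_inv_rev, hL.inv]
    have c1 : gp L s⁻¹ t ≤ 8 * L x := by
      by_contra hc
      push Not at hc
      apply hcase
      have := hL.overlap x y⁻¹ hx hx2 ((ii x).2 hy4) ((ii' x).2 hy2) β α (by omega) hα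
        (by have := (ii x⁻¹).2 hy3; rwa [inv_inv] at this) (by rw [hs] at hc; simpa using hc)
      have h2 := congrArg (fun g => g⁻¹) this
      simp only [mul_inv_rev, inv_inv] at h2
      exact h2.symm
    have yn := hL.nonneg y
    have Ls : 19 * L x + L y ≤ L s := by
      have q2 := hL.gp_pow_le x⁻¹ y (by rwa [hL.inv]) (by
        rw [← mul_inv_rev, hL.inv, hL.inv, hx2]) (by rwa [inv_inv]) α (by omega)
      have q3 : gp L (x⁻¹ ^ α) y ≤ L x := by rw [q2.1, ← hL.inv x]; exact q2.2
      unfold gp at q3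
      rw [inv_pow, inv_inv, hL.inv, pl] at q3
      linarith
    have Lt : 19 * L x + L y ≤ L t := by
      have q2 := hL.gp_pow_le x⁻¹ y⁻¹ (by rwa [hL.inv]) (by
        rw [← mul_inv_rev, hL.inv, hL.inv, hx2]) ((ii x⁻¹).2 hy3) β (by omega)
      have q3 : gp L (x⁻¹ ^ β) y⁻¹ ≤ L x := by rw [q2.1, ← hL.inv x]; exact q2.2
      unfold gp at q3
      rw [inv_pow, inv_inv, hL.inv, hL.inv, pl] at q3
      linarith
    have Lg : L (s * t) = L s + L t - gp L s⁻¹ t := by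
      unfold gp; rw [inv_inv, hL.inv]; ring
    have p1 : gp L (s * t)⁻¹ s = gp L t⁻¹ s := by
      apply hL.iso
      have : gp L (s * t)⁻¹ t⁻¹ = 2 * L t - gp L s⁻¹ t := by
        have e : ((s * t)⁻¹)⁻¹ * t⁻¹ = s := by group
        unfold gp at Lg ⊢
        rw [e, hL.inv, hL.inv]; linarith
      linarith
    have p2 : gp L (s * t) (s * t)⁻¹ = gp L s (s * t)⁻¹ := by
      apply hL.iso
      have : gp L (s * t) s = 2 * L s - gp L s⁻¹ t := by
        have e : (s * t)⁻¹ * s = t⁻¹ := by group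
        unfold gp at Lg ⊢
        rw [e, hL.inv]; linarith
      rw [hL.gp_comm s, p1]
      linarith
    have p3 : gp L (s * t)⁻¹ (s * t) = gp L t⁻¹ s := by
      rw [hL.gp_comm, p2, hL.gp_comm, p1]
    have c20 := hL.gp_nonneg t⁻¹ s
    have := (hL.pow_aux (s * t) _ p3 (by linarith) (C.toNat + 1)).1
    have h5 := hC (C.toNat + 1 + 1)
    rw [eg, this] at h5
    push_cast at h5
    rw [Int.toNat_of_nonneg C0] at h5
    have h6 : 4 ≤ L (s * t) - gp L t⁻¹ s := by linarith
    nlinarith [mul_nonneg (show (0:ℤ) ≤ C + 1 by linarith) (sub_nonneg.2 h6)]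

end TreeLen
end TreeLength

section Words
variable {ι : Type*} {M : ι → Type*} [∀ i, Group (M i)]

/-- Reduced lists of syllables. -/
def RedList (l : List (Σ i, M i)) : Prop :=
  (∀ a ∈ l, a.2 ≠ 1) ∧ l.IsChain fun a b => a.1 ≠ b.1

/-- The product of a list of syllables. -/
def lprod (l : List (Σ i, M i)) : CoprodI M := (l.map fun a => CoprodI.of a.2).prod

/-- The inverse list. -/
def linv (l : List (Σ i, M i)) : List (Σ i, M i) := (l.map fun a => ⟨a.1, a.2⁻¹⟩).reverse

open Classical in
/-- The normal form. -/
noncomputable def nf (g : CoprodI M) : List (Σ i, M i) := (CoprodI.Word.equiv g).toList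

/-- Syllable length. -/
noncomputable def slen (g : CoprodI M) : ℤ := (nf g).length

open Classical in
/-- The length of the common prefix, doubled and refined. -/
noncomputable def cpf : List (Σ i, M i) → List (Σ i, M i) → ℤ
  | a :: l, b :: m => if a = b then 2 + cpf l m else if a.1 = b.1 then 1 else 0
  | [], _ => 0
  | _ :: _, [] => 0

theorem nf_red (g : CoprodI M) : RedList (nf g) := by
  classical
  exact ⟨(CoprodI.Word.equiv g).ne_one, (CoprodI.Word.equiv g).chain_ne⟩

theorem lprod_nf (g : CoprodI M) : lprod (nf g) = g := by
  classical
  exact CoprodI.Word.equiv.symm_apply_apply g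

theorem nf_lprod (l : List (Σ i, M i)) (h : RedList l) : nf (lprod l) = l := by
  classical
  have := CoprodI.Word.equiv.apply_symm_apply (⟨l, h.1, h.2⟩ : CoprodI.Word M)
  exact congrArg CoprodI.Word.toList this

theorem slen_lprod (l : List (Σ i, M i)) (h : RedList l) : slen (lprod l) = l.length := by
  rw [slen, nf_lprod l h]

theorem lprod_append (l m : List (Σ i, M i)) : lprod (l ++ m) = lprod l * lprod m := by
  simp [lprod]

theorem lprod_cons (a : Σ i, M i) (m : List (Σ i, M i)) :
    lprod (a :: m) = CoprodI.of a.2 * lprod m := by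
  simp [lprod]

theorem linv_cons (a : Σ i, M i) (l : List (Σ i, M i)) :
    linv (a :: l) = linv l ++ [⟨a.1, a.2⁻¹⟩] := by
  simp [linv]

theorem lprod_linv (l : List (Σ i, M i)) : lprod (linv l) = (lprod l)⁻¹ := by
  induction l with
  | nil => simp [linv, lprod]
  | cons a l ih =>
    rw [linv_cons, lprod_append, ih, lprod_cons, lprod_cons]
    simp [lprod]

theorem linv_length (l : List (Σ i, M i)) : (linv l).length = l.length := by
  simp [linv]

theorem RedList.linv {l : List (Σ i, M i)} (h : RedList l) : RedList (linv l) := by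
  refine ⟨?_, ?_⟩
  · intro a ha
    simp only [_root_.linv, List.mem_reverse, List.mem_map] at ha
    obtain ⟨b, hb, rfl⟩ := ha
    simpa using h.1 b hb
  · rw [_root_.linv, List.isChain_reverse, List.isChain_map]
    exact h.2.imp fun a b hab => hab.symm

theorem RedList.tail {a : Σ i, M i} {l : List (Σ i, M i)} (h : RedList (a :: l)) : RedList l :=
  ⟨fun b hb => h.1 b (by simp [hb]), h.2.tail⟩

theorem red_join {a b : Σ i, M i} {l m : List (Σ i, M i)} (h : RedList (l ++ [a]))
    (h' : RedList (b :: m)) (hab : a.1 ≠ b.1) : RedList ((l ++ [a]) ++ (b :: m)) := by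
  refine ⟨?_, ?_⟩
  · intro c hc
    rcases List.mem_append.1 hc with hc | hc
    · exact h.1 c hc
    · exact h'.1 c hc
  · refine h.2.append h'.2 ?_
    intro x hx y hy
    simp at hx hy
    subst hx; subst hy; exact hab

theorem slen_inv (g : CoprodI M) : slen g⁻¹ = slen g := by
  conv_lhs => rw [← lprod_nf g, ← lprod_linv, slen_lprod _ (nf_red g).linv, linv_length]
  rfl

theorem red_replace {i : ι} {u v : M i} {m : List (Σ i, M i)} (h : RedList (⟨i, u⟩ :: m))
    (hv : v ≠ 1) : RedList (⟨i, v⟩ :: m) := by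
  refine ⟨?_, ?_⟩
  · intro c hc
    rcases List.mem_cons.1 hc with rfl | hc
    · exact hv
    · exact h.1 c (by simp [hc])
  · have := h.2
    rw [List.isChain_cons] at this ⊢
    exact this

theorem red_glue {i : ι} {u v w : M i} {l m : List (Σ i, M i)} (h : RedList (l ++ [⟨i, u⟩]))
    (h' : RedList (⟨i, v⟩ :: m)) (hw : w ≠ 1) : RedList (l ++ (⟨i, w⟩ :: m)) := by
  have h2 := red_replace h' hw
  refine ⟨?_, ?_⟩
  · intro c hc
    rcases List.mem_append.1 hc with hc | hc
    · exact h.1 c (by simp [hc])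
    · exact h2.1 c hc
  · have h1 := List.isChain_append.1 h.2
    refine h1.1.append h2.2 ?_
    intro x hx y hy
    have := h1.2.2 x hx ⟨i, u⟩ (by simp)
    simp at hy
    subst hy; exact this

theorem slen_cpf (l m : List (Σ i, M i)) (hl : RedList l) (hm : RedList m) :
    slen ((lprod l)⁻¹ * lprod m) = l.length + m.length - cpf l m := by
  induction l generalizing m with
  | nil => simp [cpf, lprod, ← slen_lprod m hm]
  | cons a l ih =>
    cases m with
    | nil =>
      have : lprod ([] : List (Σ i, M i)) = 1 := rfl
      rw [this, mul_one, slen_inv, slen_lprod _ hl]; simp [cpf]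
    | cons b m =>
      by_cases hab : a = b
      · subst hab
        have e : (lprod (a :: l))⁻¹ * lprod (a :: m) = (lprod l)⁻¹ * lprod m := by
          rw [lprod_cons, lprod_cons]; group
        rw [e, ih m hl.tail hm.tail]
        simp only [cpf, if_true, List.length_cons]
        push_cast; ring
      · by_cases hi : a.1 = b.1
        · obtain ⟨i, u⟩ := a
          obtain ⟨j, v⟩ := b
          obtain rfl : i = j := hi
          have huv : u⁻¹ * v ≠ 1 := by
            intro h
            apply hab
            rw [inv_mul_eq_one.1 h]
          have e : (lprod (⟨i, u⟩ :: l))⁻¹ * lprod (⟨i, v⟩ :: m)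
              = lprod (linv l ++ (⟨i, u⁻¹ * v⟩ :: m)) := by
            rw [lprod_append, lprod_linv, lprod_cons, lprod_cons, lprod_cons]
            simp [mul_assoc]
          have h1 := hl.linv
          rw [linv_cons] at h1
          rw [e, slen_lprod _ (red_glue h1 hm huv)]
          simp only [cpf, if_neg hab, if_true, List.length_cons, List.length_append, linv_length]
          push_cast; ring
        · have h1 := hl.linv
          rw [linv_cons] at h1
          have h2 := red_join h1 hm hi
          rw [← lprod_linv, ← lprod_append, linv_cons, slen_lprod _ h2]
          simp only [cpf, if_neg hab, if_neg hi, List.length_cons, List.length_append,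
            linv_length]
          push_cast; simp

theorem cpf_nonneg (l m : List (Σ i, M i)) : 0 ≤ cpf l m := by
  induction l generalizing m with
  | nil => simp [cpf]
  | cons a l ih =>
    cases m with
    | nil => simp [cpf]
    | cons b m =>
      have := ih m
      simp only [cpf]
      split_ifs <;> linarith

theorem cpf_ultra (l k m : List (Σ i, M i)) (c : ℤ) (h1 : c ≤ cpf l k) (h2 : c ≤ cpf k m) :
    c ≤ cpf l m := by
  induction l generalizing k m c with
  | nil => simpa [cpf] using h1
  | cons a l ih =>
    cases k with
    | nil => exact (show c ≤ 0 by simpa [cpf] using h1).trans (cpf_nonneg _ _)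
    | cons d k =>
      cases m with
      | nil => simpa [cpf] using h2
      | cons b m =>
        have i1 := ih k m (c - 2)
        have i2 := cpf_nonneg l m
        simp only [cpf] at h1 h2 ⊢
        by_cases e1 : a = d
        · subst e1
          by_cases e2 : a = b
          · subst e2
            simp only [if_true] at h1 h2 ⊢
            linarith [i1 (by linarith) (by linarith)]
          · simp only [if_neg e2] at h2 ⊢
            exact h2
        · by_cases e2 : d = b
          · subst e2
            simp only [if_neg e1] at h1 ⊢
            exact h1
          · simp only [if_neg e1, if_neg e2] at h1 h2
            split_ifs at * <;> first | linarith | (exfalso; simp_all)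

theorem slen_gp (g h : CoprodI M) : slen g + slen h - slen (g⁻¹ * h) = cpf (nf g) (nf h) := by
  have := slen_cpf (nf g) (nf h) (nf_red g) (nf_red h)
  rw [lprod_nf, lprod_nf] at this
  rw [this]; simp [slen]

theorem slen_treeLen : TreeLen (slen : CoprodI M → ℤ) where
  one := by
    have := slen_lprod ([] : List (Σ i, M i)) ⟨by simp, by simp⟩
    simpa [lprod] using this
  eq_one g h := by
    have : nf g = [] := by
      apply List.eq_nil_of_length_eq_zero
      unfold slen at h
      omega
    rw [← lprod_nf g, this]; rfl
  inv := slen_inv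
  hyp g k h c := by
    rw [slen_gp, slen_gp, slen_gp]
    exact cpf_ultra _ _ _ c

theorem slen_of_le {i : ι} (u : M i) : slen (CoprodI.of u) ≤ 1 := by
  by_cases hu : u = 1
  · subst hu
    rw [map_one, slen_treeLen.one]; norm_num
  · have := slen_lprod ([⟨i, u⟩] : List (Σ i, M i)) ⟨by simpa using hu, by simp⟩
    simp [lprod] at this
    exact this.le

/-- Every element is conjugate into a factor or to a cyclically reduced element. -/
theorem cyc_red [Nonempty ι] (n : ℕ) (x : CoprodI M) (hn : slen x ≤ n) :
    ∃ s x₀ : CoprodI M, x = s * x₀ * s⁻¹ ∧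
      ((∃ (i : ι) (u : M i), x₀ = CoprodI.of u) ∨
        (0 < slen x₀ ∧ slen (x₀ * x₀) = 2 * slen x₀)) := by
  induction n generalizing x with
  | zero =>
    have := slen_treeLen.eq_one x (by simpa using hn)
    exact ⟨1, 1, by simp [this], Or.inl ⟨Classical.arbitrary ι, 1, by simp⟩⟩
  | succ n ih =>
    have hr := nf_red x
    have hp := lprod_nf x
    have hlen : slen x = (nf x).length := rfl
    generalize nf x = l at hr hp hlen
    rcases l with _ | ⟨a, l⟩
    · exact ⟨1, 1, by simp [← hp, lprod], Or.inl ⟨Classical.arbitrary ι, 1, by simp⟩⟩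
    rcases List.eq_nil_or_concat l with rfl | ⟨l, b, rfl⟩
    · exact ⟨1, x, by simp, Or.inl ⟨a.1, a.2, by simp [← hp, lprod]⟩⟩
    by_cases hab : a.1 = b.1
    · obtain ⟨i, u⟩ := a
      obtain ⟨j, v⟩ := b
      obtain rfl : i = j := hab
      have hl : RedList l := by
        have := hr.tail
        exact ⟨fun c hc => this.1 c (by simp [hc]), by
          have h := this.2; rw [List.concat_eq_append] at h; exact h.left_of_append⟩
      have hx : x = CoprodI.of u * lprod l * CoprodI.of v := by
        rw [← hp, lprod_cons, List.concat_eq_append, lprod_append]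
        simp [lprod, mul_assoc]
      have hle : slen (CoprodI.of (v * u) * lprod l) ≤ n := by
        have h1 := slen_treeLen.mul_le (CoprodI.of (v * u)) (lprod l)
        have h2 := slen_of_le (v * u)
        rw [slen_lprod l hl] at h1
        simp at hlen
        push_cast at hn
        linarith
      obtain ⟨s, x₀, h1, h2⟩ := ih _ hle
      refine ⟨(CoprodI.of v)⁻¹ * s, x₀, ?_, h2⟩
      have : (CoprodI.of v)⁻¹ * s * x₀ * ((CoprodI.of v)⁻¹ * s)⁻¹
          = (CoprodI.of v)⁻¹ * (s * x₀ * s⁻¹) * CoprodI.of v := by group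
      rw [this, ← h1, hx, map_mul]; group
    · refine ⟨1, x, by simp, Or.inr ⟨?_, ?_⟩⟩
      · rw [hlen]; simp; positivity
      · have h1 : RedList ((a :: l) ++ [b]) := by simpa using hr
        have := red_join h1 hr (Ne.symm hab)
        have h3 := slen_lprod _ this
        rw [lprod_append, hp] at h3
        have h4 : lprod (a :: l ++ [b]) = x := by rw [← hp]; simp
        rw [h4] at h3
        rw [h3, hlen]
        simp; ring

/-- The core: an equation without solutions in a free product. -/
theorem no_solution {o₁ o₂ : ι} (ho : o₁ ≠ o₂) (a : M o₁) (b : M o₂) (ha : a ≠ 1) (hb : b ≠ 1)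
    (α β : ℕ) (hα : 20 ≤ α) (hβ : α + 20 ≤ β) (x y z : CoprodI M)
    (heq : z * x ^ α * z⁻¹ * (y * x ^ β * y⁻¹) = CoprodI.of a * CoprodI.of b) : False := by
  classical
  have : Nonempty ι := ⟨o₁⟩
  have hT := slen_treeLen (M := M)
  obtain ⟨s, x₀, hx, hcase⟩ := cyc_red (slen x).toNat x (Int.self_le_toNat _)
  rcases hcase with ⟨i, u, rfl⟩ | ⟨hpos, hdbl⟩
  · have key : ∀ o, i ≠ o → CoprodI.lift (Pi.mulSingle o (MonoidHom.id (M o))) x = 1 := by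
      intro o hio
      rw [hx]
      simp [Pi.mulSingle_eq_of_ne hio]
    by_cases h1 : i = o₁
    · have h2 : i ≠ o₂ := fun h => ho (h1 ▸ h)
      have h3 := congrArg (CoprodI.lift (Pi.mulSingle o₂ (MonoidHom.id (M o₂)))) heq
      simp [key o₂ h2, Pi.mulSingle_eq_of_ne ho] at h3
      exact hb h3.symm
    · have h3 := congrArg (CoprodI.lift (Pi.mulSingle o₁ (MonoidHom.id (M o₁)))) heq
      simp [key o₁ h1, Pi.mulSingle_eq_of_ne ho.symm] at h3
      exact ha h3.symm
  · -- minimal double coset representative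
    set y₁ := s⁻¹ * z⁻¹ * y * s with hy₁
    let S : Set ℕ := {n | ∃ i j : ℤ, (slen (x₀ ^ i * y₁ * x₀ ^ j)).toNat = n}
    have hS : S.Nonempty := ⟨_, 0, 0, rfl⟩
    obtain ⟨i, j, hij⟩ := Nat.sInf_mem hS
    set y₀ := x₀ ^ i * y₁ * x₀ ^ j with hy₀
    have hmin : ∀ i' j' : ℤ, slen y₀ ≤ slen (x₀ ^ i' * y₀ * x₀ ^ j') := by
      intro i' j'
      have h1 : sInf S ≤ (slen (x₀ ^ i' * y₀ * x₀ ^ j')).toNat := by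
        apply Nat.sInf_le
        refine ⟨i' + i, j + j', ?_⟩
        rw [hy₀, zpow_add, zpow_add]
        simp only [mul_assoc]
      have h2 := hT.nonneg y₀
      have h3 := hT.nonneg (x₀ ^ i' * y₀ * x₀ ^ j')
      omega
    refine hT.growth x₀ y₀ hpos hdbl (by simpa using hmin (-1) 0) (by simpa using hmin 1 0)
      (by simpa using hmin 0 (-1)) (by simpa using hmin 0 1) α β hα hβ
      (2 * slen (x₀ ^ i * s⁻¹ * z⁻¹)) ?_
    intro n
    set r := x₀ ^ i * s⁻¹ * z⁻¹ with hr
    have e : x₀ ^ α * y₀ * x₀ ^ β * y₀⁻¹ = r * (CoprodI.of a * CoprodI.of b) * r⁻¹ := by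
      rw [← heq, hr, hy₀, hy₁, hx, conj_pow, conj_pow]
      group
    rw [e, conj_pow]
    have hn : ∀ n : ℕ, slen ((CoprodI.of a * CoprodI.of b : CoprodI M) ^ n) ≤ 2 * n := by
      intro n
      induction n with
      | zero => simp [hT.one]
      | succ n ih =>
        rw [pow_succ]
        have h1 := hT.mul_le ((CoprodI.of a * CoprodI.of b : CoprodI M) ^ n)
          (CoprodI.of a * CoprodI.of b)
        have h2 := hT.mul_le (CoprodI.of a : CoprodI M) (CoprodI.of b)
        have h3 := slen_of_le a
        have h4 := slen_of_le b
        push_cast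
        linarith
    have h1 := hT.mul_le (r * (CoprodI.of a * CoprodI.of b) ^ n) r⁻¹
    have h2 := hT.mul_le r ((CoprodI.of a * CoprodI.of b) ^ n)
    rw [hT.inv] at h1
    linarith [hn n]

end Words

/-- Let `H` be a verbally closed subgroup of a free product `G₁ * ⋯ * Gₙ` of
nontrivial finite groups with Kurosh decomposition `H = F * (∗ⱼ cⱼ Hⱼ cⱼ⁻¹)`, and let
two distinct free factors of `H` be conjugates of subgroups `K₁, K₂` of the same
factor `Gᵢ`.  Then for any `f, g ∈ Gᵢ` and `k₁, k₂ ∈ ℕ` with `f^{k₁} ∈ K₁` and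
`f^{k₂} ∈ g K₂ g⁻¹` we have `f^{k₁} = 1` or `f^{k₂} = 1`; in particular
`K₁ ∩ g K₂ g⁻¹ = {1}` for every `g ∈ Gᵢ`. -/
theorem kurosh_factors_cyclic_condition {ι : Type*} [Fintype ι]
    (G : ι → Type*) [∀ i, Group (G i)] [∀ i, Finite (G i)] [∀ i, Nontrivial (G i)]
    (H : Subgroup (CoprodI G)) (hvc : VerballyClosed H)
    (J : Type*) (B : Option J → Subgroup (CoprodI G))
    (X : Type*) (eF : B none ≃* FreeGroup X)
    (hconj : ∀ j : J, ∃ (i : ι) (K : Subgroup (G i)) (c : CoprodI G), K ≠ ⊥ ∧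
      B (some j) = (K.map (CoprodI.of (M := G))).map (MulAut.conj c).toMonoidHom)
    (hinj : Function.Injective (CoprodI.lift (fun o => (B o).subtype)))
    (hrange : (CoprodI.lift (fun o => (B o).subtype)).range = H)
    (j₁ j₂ : J) (hj : j₁ ≠ j₂) (i : ι) (K₁ K₂ : Subgroup (G i))
    (c₁ c₂ : CoprodI G)
    (hB₁ : B (some j₁) = (K₁.map (CoprodI.of (M := G))).map (MulAut.conj c₁).toMonoidHom)
    (hB₂ : B (some j₂) = (K₂.map (CoprodI.of (M := G))).map (MulAut.conj c₂).toMonoidHom) :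
    (∀ (f g : G i) (k₁ k₂ : ℕ), f ^ k₁ ∈ K₁ →
        f ^ k₂ ∈ K₂.map (MulAut.conj g).toMonoidHom →
        f ^ k₁ = 1 ∨ f ^ k₂ = 1) ∧
    ∀ g : G i, K₁ ⊓ K₂.map (MulAut.conj g).toMonoidHom = ⊥ := by
  have main : ∀ (f g : G i) (k₁ k₂ : ℕ), f ^ k₁ ∈ K₁ →
      f ^ k₂ ∈ K₂.map (MulAut.conj g).toMonoidHom → f ^ k₁ = 1 ∨ f ^ k₂ = 1 := by
    intro f g k₁ k₂ h1 h2
    by_contra hcon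
    push Not at hcon
    obtain ⟨hf1, hf2⟩ := hcon
    obtain ⟨m, hm, hmf⟩ := h2
    have hmf' : g * m * g⁻¹ = f ^ k₂ := by simpa using hmf
    have hm1 : m ≠ 1 := by
      rintro rfl
      apply hf2
      rw [← hmf']; simp
    have hord : 0 < orderOf f := orderOf_pos f
    set n := orderOf f with hn
    let α := k₁ + n * 20
    let β := k₂ + n * (α + 20)
    have hα : 20 ≤ α := by simp only [α]; nlinarith
    have hβ : α + 20 ≤ β := by simp only [β]; nlinarith
    have hfα : f ^ α = f ^ k₁ := by
      simp only [α]; rw [pow_add, pow_mul, hn, pow_orderOf_eq_one]; simp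
    have hfβ : f ^ β = f ^ k₂ := by
      simp only [β]; rw [pow_add, pow_mul, hn, pow_orderOf_eq_one]; simp
    have ha : c₁ * CoprodI.of (f ^ k₁) * c₁⁻¹ ∈ B (some j₁) := by
      rw [hB₁]
      exact ⟨CoprodI.of (f ^ k₁), ⟨f ^ k₁, h1, rfl⟩, by simp⟩
    have hb : c₂ * CoprodI.of m * c₂⁻¹ ∈ B (some j₂) := by
      rw [hB₂]
      exact ⟨CoprodI.of m, ⟨m, hm, rfl⟩, by simp⟩
    set a : B (some j₁) := ⟨_, ha⟩ with ha_def
    set b : B (some j₂) := ⟨_, hb⟩ with hb_def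
    have ha1 : a ≠ 1 := by
      intro h
      have h' := congrArg Subtype.val h
      simp only [ha_def, Subgroup.coe_one, conj_eq_one_iff] at h'
      exact hf1 (CoprodI.of_injective i (h'.trans (map_one _).symm))
    have hb1 : b ≠ 1 := by
      intro h
      have h' := congrArg Subtype.val h
      simp only [hb_def, Subgroup.coe_one, conj_eq_one_iff] at h'
      exact hm1 (CoprodI.of_injective i (h'.trans (map_one _).symm))
    let Φ := CoprodI.lift (fun o => (B o).subtype)
    let h₀ : CoprodI (fun o => B o) :=
      CoprodI.of (M := fun o => B o) (i := some j₁) a *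
        CoprodI.of (M := fun o => B o) (i := some j₂) b
    have hΦ : Φ h₀ = c₁ * CoprodI.of (f ^ k₁) * c₁⁻¹ * (c₂ * CoprodI.of m * c₂⁻¹) := by
      simp only [Φ, h₀, map_mul, CoprodI.lift_of]
      rfl
    have hmem : Φ h₀ ∈ H := by rw [← hrange]; exact ⟨h₀, rfl⟩
    let w : FreeGroup (Fin 3) :=
      FreeGroup.of 2 * FreeGroup.of 0 ^ α * (FreeGroup.of 2)⁻¹ *
        (FreeGroup.of 1 * FreeGroup.of 0 ^ β * (FreeGroup.of 1)⁻¹)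
    obtain ⟨x, hxH, hxw⟩ := hvc 3 w (Φ h₀) hmem
      ⟨![CoprodI.of f, c₂ * CoprodI.of g⁻¹, c₁], by
        rw [hΦ]
        have hm2 : m = g⁻¹ * f ^ k₂ * g := by rw [← hmf']; group
        simp only [w, map_mul, map_inv, map_pow, FreeGroup.lift_apply_of, Matrix.cons_val]
        rw [← map_pow, ← map_pow, hfα, hfβ, hm2]
        simp only [map_mul, map_inv, map_pow]
        group⟩
    have hx' : ∀ t, ∃ q, Φ q = x t := by
      intro t
      have := hxH t
      rw [← hrange] at this
      exact this
    choose q hq using hx'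
    refine no_solution (M := fun o => B o) (o₁ := some j₁) (o₂ := some j₂) (by simpa using hj)
      a b ha1 hb1 α β hα hβ (q 0) (q 1) (q 2) ?_
    apply hinj
    change Φ _ = Φ h₀
    rw [← hxw]
    simp only [w, map_mul, map_inv, map_pow, FreeGroup.lift_apply_of, hq]
  refine ⟨main, fun g => ?_⟩
  rw [eq_bot_iff]
  intro f hf
  have := main f g 1 1 (by simpa using hf.1) (by simpa using hf.2)
  simpa using this
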